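/- arXiv:1405.3604 — 2 statements merged into one kernel-verified Lean document; each statement's English description precedes it below -/
import Mathlib

section
/- Let a = (a_1, a_2, …, a_p) be a probability vector of length p and let ε > 0. Then there exist n ∈ ℕ, probability vectors r^j = (r_1^j, …, r_p^j) for 1 ≤ j ≤ p all of whose entries are rational with denominator n (i.e. n·r_i^j ∈ ℕ ∪ {0}), and a probability vector c = (c_1, …, c_p), such that |a_i − r_i^j| < ε for all 1 ≤ i, j ≤ p and a = Σ_{j=1}^p c_j · r^j. -/
/-- **Lemma (rational decomposition of probability vectors).** For every
probability vector `a = (a_1, …, a_p)` and `ε > 0` there are `n ∈ ℕ`,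
probability vectors `r^1, …, r^p` of length `p` with entries rational with
denominator `n`, and a probability vector `c = (c_1, …, c_p)` such that
`|a_i − r_i^j| < ε` for all `i, j` and `a = Σ_j c_j · r^j`. -/
theorem rational_decomposition_of_probability_vector
    (p : ℕ) (a : Fin p → ℝ) (ha0 : ∀ i, 0 ≤ a i) (ha1 : ∑ i, a i = 1)
    (ε : ℝ) (hε : 0 < ε) :
    ∃ (n : ℕ) (r : Fin p → Fin p → ℝ) (c : Fin p → ℝ),
      0 < n ∧
      (∀ j i, 0 ≤ r j i) ∧ (∀ j, ∑ i, r j i = 1) ∧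
      (∀ j i, ∃ m : ℕ, r j i = (m : ℝ) / n) ∧
      (∀ i, 0 ≤ c i) ∧ (∑ j, c j = 1) ∧
      (∀ j i, |a i - r j i| < ε) ∧
      (∀ i, a i = ∑ j, c j * r j i) := by
  obtain ⟨n, hn⟩ := exists_nat_gt (p / ε)
  have hn0 : (0 : ℝ) < n := lt_of_le_of_lt (by positivity) hn
  have hpn : (p : ℝ) / n < ε := by
    rw [div_lt_iff₀ hε] at hn
    rw [div_lt_iff₀ hn0]
    linarith
  -- Integer parts `l`, fractional parts `f`; the total mass `k` of `f` is a natural number.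
  obtain ⟨l, hl⟩ : ∃ l : Fin p → ℕ, ∀ i, (l i : ℝ) ≤ n * a i ∧ n * a i < l i + 1 :=
    ⟨fun i => ⌊n * a i⌋₊, fun i =>
      ⟨Nat.floor_le (mul_nonneg hn0.le (ha0 i)), Nat.lt_floor_add_one _⟩⟩
  obtain ⟨f, hf⟩ : ∃ f : Fin p → ℝ, ∀ i, f i = n * a i - l i := ⟨_, fun _ => rfl⟩
  have hf0 : ∀ i, 0 ≤ f i := fun i => by linarith [hf i, (hl i).1]
  have hf1 : ∀ i, f i ≤ 1 := fun i => by linarith [hf i, (hl i).2]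
  have hsum : ∑ i, f i = n - ∑ i, (l i : ℝ) := by
    simp only [hf, Finset.sum_sub_distrib, ← Finset.mul_sum, ha1, mul_one]
  have hle : ∑ i, l i ≤ n := by
    have h := Finset.sum_nonneg fun i (_ : i ∈ Finset.univ) => hf0 i
    rw [hsum] at h
    exact_mod_cast sub_nonneg.mp h
  obtain ⟨k, hk⟩ := Nat.exists_eq_add_of_le hle
  have hkR : (n : ℝ) = ∑ i, (l i : ℝ) + k := by exact_mod_cast hk
  have hfk : ∑ i, f i = k := by linarith
  have hkp : (k : ℝ) ≤ p := by
    simpa [hfk] using Finset.sum_le_sum fun i (_ : i ∈ Finset.univ) => hf1 i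
  have hfle : ∀ i, f i ≤ k := fun i =>
    hfk ▸ Finset.single_le_sum (fun i _ => hf0 i) (Finset.mem_univ i)
  obtain ⟨c, hc0, hc1, hck⟩ : ∃ c : Fin p → ℝ,
      (∀ i, 0 ≤ c i) ∧ ∑ i, c i = 1 ∧ ∀ i, c i * k = f i := by
    rcases Nat.eq_zero_or_pos k with rfl | hkpos
    · refine ⟨a, ha0, ha1, fun i => ?_⟩
      have h := hfle i
      have h' := hf0 i
      push_cast at h ⊢
      linarith
    · have hk0 : (0 : ℝ) < k := by exact_mod_cast hkpos
      refine ⟨fun i => f i / k, fun i => div_nonneg (hf0 i) hk0.le, ?_, fun i => ?_⟩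
      · rw [← Finset.sum_div, hfk, div_self hk0.ne']
      · exact div_mul_cancel₀ _ hk0.ne'
  refine ⟨n, fun j i => ((l i + if i = j then k else 0 : ℕ) : ℝ) / n, c,
    by exact_mod_cast hn0, fun j i => by positivity, fun j => ?_, fun j i => ⟨_, rfl⟩,
    hc0, hc1, fun j i => ?_, fun i => ?_⟩
  · rw [← Finset.sum_div, ← Nat.cast_sum, Finset.sum_add_distrib, Finset.sum_ite_eq' Finset.univ j,
      if_pos (Finset.mem_univ j), ← hk, div_self hn0.ne']
  · have key : a i - ((l i + if i = j then k else 0 : ℕ) : ℝ) / n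
        = (f i - (if i = j then k else 0 : ℕ)) / n := by
      rw [hf]
      push_cast
      field_simp
      ring
    rw [key, abs_div, abs_of_pos hn0]
    refine lt_of_le_of_lt ?_ hpn
    gcongr
    have h0 := hf0 i
    have h1 := hfle i
    rw [abs_le]
    split_ifs <;> push_cast <;> constructor <;> linarith
  · have key : ∀ j, c j * (((l i + if i = j then k else 0 : ℕ) : ℝ) / n)
        = (c j * l i + if i = j then c j * k else 0) / n := by
      intro j
      split_ifs <;> push_cast <;> ring
    simp only [key]
    rw [← Finset.sum_div, Finset.sum_add_distrib, ← Finset.sum_mul, hc1, Finset.sum_ite_eq,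
      if_pos (Finset.mem_univ i), hck, hf, eq_div_iff hn0.ne']
    ring
end

section
/- Let (X, μ) be a probability space, let ξ and β be finite partitions of X with ξ refining β and coarsening map π_β : ξ → β, let q be a finite probability vector, and let 0 < r ≤ 1. Assume H(ξ|β) < r·H(q). Then there are δ > 0, ε_0 > 0, and n_0 ∈ ℕ such that for all 0 < ε ≤ ε_0 and all n ≥ n_0/ε, there exist injections f_b : {c ∈ L^n_{ξ,ε} : π_β ∘ c = b} → L^{⌊r·n⌋}_{q,ε} for every b ∈ L^n_{β,ε}, satisfying d̄(f_b(c), f_b(c')) > 20·δ·|q| for every b and all c ≠ c' in the domain of f_b. -/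
open MeasureTheory

/-- Empirical frequency of the symbol `t` in the word `ℓ : Fin n → Fin k`. -/
noncomputable def freqIn {n k : ℕ} (ℓ : Fin n → Fin k) (t : Fin k) : ℝ :=
  ({i : Fin n | ℓ i = t}.ncard : ℝ) / n

/-- The normalized Hamming distance `d̄` between two words of length `k`. -/
noncomputable def dbar {k q : ℕ} (ℓ ℓ' : Fin k → Fin q) : ℝ :=
  ({i : Fin k | ℓ i ≠ ℓ' i}.ncard : ℝ) / k

/-- Weighted counting: if every word of `S` has weight at least `D` for a product weight whose
factors have total mass at most `A`, then `S` has at most `A ^ n / D` elements. -/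
theorem card_mul_le_pow_of_prod_weight {n m : ℕ} (g : Fin n → Fin m → ℝ) (hg : ∀ i t, 0 ≤ g i t)
    (A D : ℝ) (hA : ∀ i, ∑ t, g i t ≤ A) (S : Finset (Fin n → Fin m))
    (hS : ∀ c ∈ S, D ≤ ∏ i, g i (c i)) : (S.card : ℝ) * D ≤ A ^ n := by
  calc (S.card : ℝ) * D = ∑ _c ∈ S, D := by simp
    _ ≤ ∑ c ∈ S, ∏ i, g i (c i) := Finset.sum_le_sum hS
    _ ≤ ∑ c : Fin n → Fin m, ∏ i, g i (c i) :=
      Finset.sum_le_sum_of_subset_of_nonneg (Finset.subset_univ _)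
        fun c _ _ => Finset.prod_nonneg fun i _ => hg i _
    _ = ∏ i, ∑ t, g i t := by
      rw [Finset.prod_univ_sum, Fintype.piFinset_univ]
    _ ≤ ∏ _i : Fin n, A :=
      Finset.prod_le_prod (fun i _ => Finset.sum_nonneg fun t _ => hg i t) fun i _ => hA i
    _ = A ^ n := by simp

theorem ncard_setOf_eq_card_filter {α : Type*} [Fintype α] (P : α → Prop) [DecidablePred P] :
    {i | P i}.ncard = (Finset.univ.filter P).card := by
  rw [← Set.ncard_coe_finset]
  simp

theorem sum_comp_eq_mul_sum_freqIn {n m : ℕ} (hn : 0 < n) (c : Fin n → Fin m) (a : Fin m → ℝ) :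
    ∑ i, a (c i) = n * ∑ t, freqIn c t * a t := by
  have hn' : (n : ℝ) ≠ 0 := by positivity
  rw [← Finset.sum_fiberwise Finset.univ c, Finset.mul_sum]
  refine Finset.sum_congr rfl fun t _ => ?_
  rw [Finset.sum_congr rfl (g := fun _ => a t)
    (fun i hi => by rw [(Finset.mem_filter.mp hi).2])]
  rw [freqIn, ncard_setOf_eq_card_filter, Finset.sum_const, nsmul_eq_mul]
  field_simp

/-- Words with empirical distribution close to `p` lying over a given word `b` are at most
exponentially many, at rate the conditional entropy. -/
theorem exists_card_words_over_le_exp {m m' : ℕ} (π : Fin m → Fin m') (p : Fin m → ℝ)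
    (s : Fin m' → ℝ) (hp : ∀ t, 0 ≤ p t) (hp1 : ∑ t, p t ≤ 1)
    (hs : ∀ u, ∑ t with π t = u, p t ≤ s u) {κ : ℝ} (hκ : 0 < κ) :
    ∃ ε₀ : ℝ, 0 < ε₀ ∧ ∀ ε ≤ ε₀, ∀ n : ℕ, 0 < n → ∀ (b : Fin n → Fin m')
      (S : Finset (Fin n → Fin m)),
      (∀ c ∈ S, (∀ t, |freqIn c t - p t| ≤ ε) ∧ π ∘ c = b) →
      (S.card : ℝ) ≤ Real.exp (n * (∑ t, -(p t * Real.log (p t / s (π t))) + κ)) := by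
  have hps : ∀ t, p t ≤ s (π t) := fun t =>
    (Finset.single_le_sum (f := p) (fun t _ => hp t) (by simp)).trans (hs (π t))
  have hs0 : ∀ t, 0 ≤ s (π t) := fun t => (hp t).trans (hps t)
  set v : Fin m → ℝ := fun t => p t / s (π t) with hv
  have hv0 : ∀ t, 0 ≤ v t := fun t => div_nonneg (hp t) (hs0 t)
  obtain ⟨η, hη, hmη⟩ : ∃ η : ℝ, 0 < η ∧ m * η ≤ κ / 2 := by
    refine ⟨κ / 2 / (m + 1), by positivity, ?_⟩
    rw [mul_div_assoc', div_le_iff₀ (by positivity)]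
    nlinarith [(Nat.cast_nonneg m : (0 : ℝ) ≤ m)]
  have hN : (0 : ℝ) < 1 + m * η := by positivity
  set w : Fin m → ℝ := fun t => (v t + η) / (1 + m * η) with hw
  have hw0 : ∀ t, 0 < w t := fun t => div_pos (by linarith [hv0 t]) hN
  have hwsum : ∀ u, ∑ t with π t = u, w t ≤ 1 := by
    intro u
    rw [hw, ← Finset.sum_div, div_le_one hN, Finset.sum_add_distrib]
    refine add_le_add ?_ ?_
    · rw [Finset.sum_congr rfl (g := fun t => p t / s u)
        (fun t ht => by simp only [hv, (Finset.mem_filter.mp ht).2]), ← Finset.sum_div]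
      exact div_le_one_of_le₀ (hs u) ((Finset.sum_nonneg fun t _ => hp t).trans (hs u))
    · rw [Finset.sum_const, nsmul_eq_mul]
      gcongr
      exact_mod_cast (Finset.card_filter_le _ _).trans (by simp)
  have hlog : ∑ t, -(p t * Real.log (w t)) ≤ ∑ t, -(p t * Real.log (v t)) + κ / 2 := by
    have key : ∀ t, -(p t * Real.log (w t)) ≤ -(p t * Real.log (v t)) + p t * (m * η) := by
      intro t
      rcases (hp t).eq_or_lt with h | h
      · simp [← h]
      · have hvt : 0 < v t := div_pos h (h.trans_le (hps t))
        have h1 : Real.log (v t) ≤ Real.log (v t + η) := Real.log_le_log hvt (by linarith)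
        have h2 : Real.log (1 + m * η) ≤ m * η := by
          linarith [Real.log_le_sub_one_of_pos hN]
        have h3 : Real.log (w t) = Real.log (v t + η) - Real.log (1 + m * η) :=
          Real.log_div (by positivity) hN.ne'
        rw [h3]
        nlinarith
    calc ∑ t, -(p t * Real.log (w t))
        ≤ ∑ t, (-(p t * Real.log (v t)) + p t * (m * η)) := Finset.sum_le_sum fun t _ => key t
      _ = ∑ t, -(p t * Real.log (v t)) + (∑ t, p t) * (m * η) := by
        rw [Finset.sum_add_distrib, Finset.sum_mul]
      _ ≤ _ := by
        have : (∑ t, p t) * (m * η) ≤ 1 * (m * η) := by gcongr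
        linarith
  set L : ℝ := ∑ t, |Real.log (w t)| with hL
  have hL0 : 0 ≤ L := Finset.sum_nonneg fun t _ => abs_nonneg _
  refine ⟨κ / 2 / (L + 1), by positivity, fun ε hε n hn b S hS => ?_⟩
  set E : ℝ := n * (∑ t, -(p t * Real.log (v t)) + κ) with hE
  have hεL : ε * L ≤ κ / 2 := by
    have h1 : ε * L ≤ κ / 2 / (L + 1) * L := by gcongr
    have h2 : κ / 2 / (L + 1) * L ≤ κ / 2 := by
      rw [div_mul_eq_mul_div, div_le_iff₀ (by positivity)]
      nlinarith
    linarith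
  have hcount := card_mul_le_pow_of_prod_weight (n := n) (m := m)
    (fun i t => if π t = b i then w t else 0)
    (fun i t => by split_ifs <;> [exact (hw0 t).le; exact le_rfl])
    1 (Real.exp (-E)) (fun i => by rw [← Finset.sum_filter]; exact hwsum _) S
    (by
      intro c hc
      obtain ⟨hc1, hc2⟩ := hS c hc
      have : ∀ i, (if π (c i) = b i then w (c i) else 0) = Real.exp (Real.log (w (c i))) := by
        intro i
        rw [if_pos (show π (c i) = b i from congrFun hc2 i), Real.exp_log (hw0 _)]
      simp only [this]
      rw [← Real.exp_sum, sum_comp_eq_mul_sum_freqIn hn c fun t => Real.log (w t),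
        Real.exp_le_exp, hE, ← mul_neg]
      gcongr
      have h1 : ∑ t, -(freqIn c t * Real.log (w t))
          ≤ ∑ t, (-(p t * Real.log (w t)) + ε * |Real.log (w t)|) := by
        refine Finset.sum_le_sum fun t _ => ?_
        have h2 : -((freqIn c t - p t) * Real.log (w t)) ≤ ε * |Real.log (w t)| := by
          refine (neg_le_abs _).trans ?_
          rw [abs_mul]
          gcongr
          exact hc1 t
        linarith
      rw [Finset.sum_add_distrib, ← Finset.mul_sum, ← hL] at h1
      rw [Finset.sum_neg_distrib] at h1
      linarith)
  rw [one_pow, Real.exp_neg, ← div_eq_mul_inv, div_le_one (Real.exp_pos _)] at hcount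
  exact hcount

/-- Small Hamming balls have at most exponential size with small rate. -/
theorem exists_card_dbar_ball_le_exp (m : ℕ) {κ : ℝ} (hκ : 0 < κ) :
    ∃ ρ : ℝ, 0 < ρ ∧ ∀ k : ℕ, 0 < k → ∀ (w₀ : Fin k → Fin m) (S : Finset (Fin k → Fin m)),
      (∀ w ∈ S, dbar w w₀ ≤ ρ) → (S.card : ℝ) ≤ Real.exp (k * κ) := by
  obtain ⟨L, hL, hmL⟩ : ∃ L : ℝ, 0 < L ∧ m * Real.exp (-L) ≤ κ / 2 := by
    have h := (Real.tendsto_exp_neg_atTop_nhds_zero.const_mul (m : ℝ))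
    rw [mul_zero] at h
    exact ((Filter.eventually_gt_atTop 0).and
      (h.eventually_le_const (by positivity : (0 : ℝ) < κ / 2))).exists
  refine ⟨κ / 2 / L, by positivity, fun k hk w₀ S hS => ?_⟩
  have hk' : (0 : ℝ) < k := by exact_mod_cast hk
  have hcount := card_mul_le_pow_of_prod_weight (n := k) (m := m)
    (fun i t => if t ≠ w₀ i then Real.exp (-L) else 1)
    (fun i t => by split_ifs <;> positivity)
    (Real.exp (κ / 2)) (Real.exp (-(k * (κ / 2))))
    (fun i => by
      have h1 : ∑ t, (if t ≠ w₀ i then Real.exp (-L) else 1)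
          ≤ ∑ t, (Real.exp (-L) + if t = w₀ i then 1 else 0) := by
        refine Finset.sum_le_sum fun t _ => ?_
        by_cases h : t = w₀ i <;> simp [h, (Real.exp_pos (-L)).le]
      rw [Finset.sum_add_distrib] at h1
      simp only [Finset.sum_const, Finset.card_univ, Fintype.card_fin, nsmul_eq_mul,
        Finset.sum_ite_eq', Finset.mem_univ, if_true] at h1
      linarith [Real.add_one_le_exp (κ / 2)]) S
    (by
      intro w hw
      rw [Finset.prod_ite, Finset.prod_const, Finset.prod_const_one, mul_one, ← Real.exp_nat_mul,
        Real.exp_le_exp]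
      have h := hS w hw
      rw [dbar, ncard_setOf_eq_card_filter, div_le_iff₀ hk', div_mul_eq_mul_div,
        le_div_iff₀ hL] at h
      linarith)
  rw [← Real.exp_nat_mul, Real.exp_neg, ← div_eq_mul_inv, div_le_iff₀ (Real.exp_pos _),
    ← Real.exp_add] at hcount
  rwa [← mul_add, add_halves] at hcount

/-- A maximal separated subset of `T` has at least `T.card / M` elements if balls have at most `M`
elements. -/
theorem exists_separated_subset {k m : ℕ} (T : Finset (Fin k → Fin m)) (ρ M : ℝ) (hρ : 0 ≤ ρ)
    (hM : ∀ (w₀ : Fin k → Fin m) (S : Finset (Fin k → Fin m)),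
      (∀ w ∈ S, dbar w w₀ ≤ ρ) → (S.card : ℝ) ≤ M) :
    ∃ P ⊆ T, (∀ x ∈ P, ∀ y ∈ P, x ≠ y → ρ < dbar x y) ∧ (T.card : ℝ) ≤ P.card * M := by
  classical
  have hcomm : ∀ x y : Fin k → Fin m, dbar x y = dbar y x := by
    intro x y
    simp only [dbar, ne_comm]
  have hself : ∀ x : Fin k → Fin m, dbar x x = 0 := by
    intro x
    simp [dbar]
  obtain ⟨P, hP, hmax⟩ := Finset.exists_max_image
    (T.powerset.filter fun P => ∀ x ∈ P, ∀ y ∈ P, x ≠ y → ρ < dbar x y) Finset.card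
    ⟨∅, by simp⟩
  rw [Finset.mem_filter, Finset.mem_powerset] at hP
  refine ⟨P, hP.1, hP.2, ?_⟩
  have hcover : T ⊆ P.biUnion fun p => Finset.univ.filter fun w => dbar w p ≤ ρ := by
    intro w hw
    simp only [Finset.mem_biUnion, Finset.mem_filter, Finset.mem_univ, true_and]
    by_contra! hfar
    have hwP : w ∉ P := fun h => by linarith [hfar w h, hself w]
    have h := hmax (insert w P) (by
      rw [Finset.mem_filter, Finset.mem_powerset]
      refine ⟨Finset.insert_subset hw hP.1, fun x hx y hy hxy => ?_⟩
      rcases Finset.mem_insert.mp hx with rfl | hx <;>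
        rcases Finset.mem_insert.mp hy with rfl | hy
      · exact absurd rfl hxy
      · exact hfar y ‹y ∈ P›
      · rw [hcomm]; exact hfar x ‹x ∈ P›
      · exact hP.2 x ‹x ∈ P› y ‹y ∈ P› hxy)
    rw [Finset.card_insert_of_notMem hwP] at h
    omega
  calc (T.card : ℝ) ≤ ∑ p ∈ P, ((Finset.univ.filter fun w => dbar w p ≤ ρ).card : ℝ) := by
        exact_mod_cast (Finset.card_le_card hcover).trans Finset.card_biUnion_le
    _ ≤ ∑ _p ∈ P, M := Finset.sum_le_sum fun p _ => hM p _ (by simp)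
    _ = P.card * M := by simp

theorem log_factorial_le (j : ℕ) :
    Real.log (j.factorial : ℝ) ≤ j * Real.log j - j + 2 * Real.log (j + 1) := by
  induction j with
  | zero => simp
  | succ j ih =>
    rw [Nat.factorial_succ, Nat.cast_mul,
      Real.log_mul (by positivity) (by positivity)]
    push_cast
    have h1 : (1 : ℝ) - 1 / (j + 1) ≤ j * (Real.log (j + 1) - Real.log j) := by
      rcases Nat.eq_zero_or_pos j with rfl | hj
      · simp
      · have hj' : (0 : ℝ) < j := by exact_mod_cast hj
        have h := Real.one_sub_inv_le_log_of_pos (x := (j + 1) / j) (by positivity)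
        rw [Real.log_div (by positivity) hj'.ne'] at h
        have h2 : (1 : ℝ) - 1 / (j + 1) = j * (1 - ((j + 1) / j : ℝ)⁻¹) := by
          field_simp
          ring
        rw [h2]
        gcongr
    have h2 : (1 : ℝ) / (j + 2) ≤ Real.log (j + 2) - Real.log (j + 1) := by
      have h := Real.one_sub_inv_le_log_of_pos (x := ((j : ℝ) + 2) / (j + 1)) (by positivity)
      rw [Real.log_div (by positivity) (by positivity)] at h
      convert h using 1
      field_simp
      ring
    have h3 : (1 : ℝ) / (j + 1) ≤ 2 * (1 / (j + 2)) := by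
      rw [mul_one_div, div_le_div_iff₀ (by positivity) (by positivity)]
      linarith [(Nat.cast_nonneg j : (0 : ℝ) ≤ j)]
    rw [show (j : ℝ) + 1 + 1 = j + 2 by ring]
    linarith

theorem le_log_factorial (j : ℕ) : j * Real.log j - j ≤ Real.log (j.factorial : ℝ) := by
  rcases Nat.eq_zero_or_pos j with rfl | hj
  · simp
  have hj' : (0 : ℝ) < j := by exact_mod_cast hj
  have h := Real.log_le_log (by positivity) (Real.pow_div_factorial_le_exp (j : ℝ) hj'.le j)
  rw [Real.log_exp, Real.log_div (by positivity) (by positivity), Real.log_pow] at h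
  linarith

/-- The words with prescribed symbol counts number at least the multinomial coefficient. -/
theorem exists_words_of_counts {k m : ℕ} (κ : Fin m → ℕ) (hκ : ∑ t, κ t = k) :
    ∃ T : Finset (Fin k → Fin m), (∀ w ∈ T, ∀ t, {i | w i = t}.ncard = κ t) ∧
      k.factorial ≤ T.card * ∏ t, (κ t).factorial := by
  classical
  let e : Fin k ≃ (Σ t, Fin (κ t)) := (finCongr hκ.symm).trans finSigmaFinEquiv.symm
  let f : Fin k → Fin m := fun i => (e i).1
  have hf : ∀ t, Fintype.card {i // f i = t} = κ t := by
    intro t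
    have e' : {i // f i = t} ≃ {x : Σ t, Fin (κ t) // x.1 = t} :=
      e.subtypeEquiv fun i => Iff.rfl
    rw [Fintype.card_congr (e'.trans (Equiv.sigmaSubtype t)), Fintype.card_fin]
  refine ⟨Finset.univ.image fun g : Equiv.Perm (Fin k) => f ∘ g, ?_, ?_⟩
  · intro w hw t
    obtain ⟨g, -, rfl⟩ := Finset.mem_image.mp hw
    rw [ncard_setOf_eq_card_filter, ← Fintype.card_subtype, ← hf t]
    exact Fintype.card_congr (g.subtypeEquiv fun i => Iff.rfl)
  · have h := Finset.card_le_mul_card_image (f := fun g : Equiv.Perm (Fin k) => f ∘ g)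
      Finset.univ (∏ t, (κ t).factorial) (by
        intro w hw
        obtain ⟨g₀, -, rfl⟩ := Finset.mem_image.mp hw
        have hst := DomMulAct.stabilizer_card f
        simp only [hf] at hst
        rw [← hst, Fintype.card_subtype]
        refine Finset.card_le_card_of_injOn (fun g => g * g₀⁻¹) ?_
          (fun x _ y _ hxy => mul_right_cancel hxy)
        intro g hg
        have hg' : f ∘ g = f ∘ g₀ := by simpa using hg
        simp only [Finset.coe_filter, Finset.mem_univ, true_and, Set.mem_ofPred_eq]
        funext i
        simpa using congrFun hg' (g₀⁻¹ i))
    rw [Finset.card_univ, Fintype.card_perm, Fintype.card_fin] at h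
    rwa [mul_comm]

/-- A probability vector scaled by `k` can be rounded to integers of the same sum. -/
theorem exists_rounding {m : ℕ} (q : Fin m → ℝ) (hq0 : ∀ t, 0 ≤ q t) (hq1 : ∑ t, q t = 1)
    (k : ℕ) : ∃ κ : Fin m → ℕ, ∑ t, κ t = k ∧ ∀ t, |(κ t : ℝ) - k * q t| ≤ m := by
  have hm : 0 < m := by
    rcases Nat.eq_zero_or_pos m with rfl | h
    · simp at hq1
    · exact h
  let t₀ : Fin m := ⟨0, hm⟩
  have hfl : ∀ t, 0 ≤ (k : ℝ) * q t := fun t => mul_nonneg (Nat.cast_nonneg _) (hq0 t)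
  have hle : ∑ t, ⌊(k : ℝ) * q t⌋₊ ≤ k := by
    have : (∑ t, (⌊(k : ℝ) * q t⌋₊ : ℝ)) ≤ ∑ t, k * q t :=
      Finset.sum_le_sum fun t _ => Nat.floor_le (hfl t)
    rw [← Finset.mul_sum, hq1, mul_one] at this
    exact_mod_cast this
  have hge : (k : ℝ) ≤ (∑ t, ⌊(k : ℝ) * q t⌋₊ : ℕ) + m := by
    have : ∑ t, k * q t ≤ ∑ t, ((⌊(k : ℝ) * q t⌋₊ : ℝ) + 1) :=
      Finset.sum_le_sum fun t _ => (Nat.lt_floor_add_one _).le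
    rw [← Finset.mul_sum, hq1, mul_one, Finset.sum_add_distrib] at this
    simpa using this
  obtain ⟨d, hd⟩ := Nat.exists_eq_add_of_le hle
  have hd' : (k : ℝ) = (∑ t, ⌊(k : ℝ) * q t⌋₊ : ℕ) + d := by exact_mod_cast hd
  refine ⟨fun t => ⌊(k : ℝ) * q t⌋₊ + if t = t₀ then d else 0, ?_, fun t => ?_⟩
  · rw [Finset.sum_add_distrib]
    simp [← hd]
  · have h1 := Nat.floor_le (hfl t)
    have h2 := Nat.lt_floor_add_one ((k : ℝ) * q t)
    have hm' : (1 : ℝ) ≤ m := by exact_mod_cast hm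
    have hd0 : (0 : ℝ) ≤ d := Nat.cast_nonneg _
    rw [abs_le]
    push_cast
    split_ifs <;> constructor <;> norm_num <;> linarith

/-- Words whose empirical distribution is as close to `q` as rounding permits are exponentially
many, at rate the entropy of `q`. -/
theorem exists_exp_le_card_words {m : ℕ} (q : Fin m → ℝ) (hq0 : ∀ t, 0 ≤ q t)
    (hq1 : ∑ t, q t = 1) {γ : ℝ} (hγ : 0 < γ) :
    ∃ K : ℕ, ∀ k ≥ K, ∃ T : Finset (Fin k → Fin m),
      (∀ w ∈ T, ∀ t, |freqIn w t - q t| ≤ m / k) ∧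
      Real.exp (k * (∑ t, Real.negMulLog (q t) - γ)) ≤ T.card := by
  have hcont : Continuous fun p : Fin m → ℝ => ∑ t, Real.negMulLog (p t) :=
    continuous_finsetSum _ fun t _ => Real.continuous_negMulLog.comp (continuous_apply t)
  obtain ⟨η, hη, hηc⟩ := Metric.continuousAt_iff.mp (hcont.continuousAt (x := q)) (γ / 2)
    (half_pos hγ)
  have hlim1 : ∀ᶠ k : ℕ in Filter.atTop, (m : ℝ) / k < η :=
    (tendsto_const_div_atTop_nhds_zero_nat (m : ℝ)).eventually_lt_const hη
  have hlim2 : ∀ᶠ k : ℕ in Filter.atTop, m * (2 * Real.log ((k : ℝ) + 1)) ≤ γ / 2 * k := by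
    have h1 : (fun x : ℝ => Real.log (x + 1)) =o[Filter.atTop] fun x : ℝ => x + 1 :=
      Real.isLittleO_log_id_atTop.comp_tendsto
        (Filter.tendsto_atTop_add_const_right _ 1 Filter.tendsto_id)
    have h2 := (h1.comp_tendsto (tendsto_natCast_atTop_atTop (R := ℝ))).def
      (c := γ / 2 / (4 * (m + 1))) (by positivity)
    filter_upwards [h2, Filter.eventually_ge_atTop 1] with k hk hk1
    have hk1' : (1 : ℝ) ≤ k := by exact_mod_cast hk1
    simp only [Function.comp_apply, Real.norm_eq_abs] at hk
    rw [abs_of_nonneg (by positivity : (0 : ℝ) ≤ (k : ℝ) + 1), div_mul_eq_mul_div,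
      le_div_iff₀ (by positivity)] at hk
    have h3 := le_abs_self (Real.log ((k : ℝ) + 1))
    have h4 : 0 ≤ Real.log ((k : ℝ) + 1) := Real.log_nonneg (by linarith)
    have h5 : Real.log ((k : ℝ) + 1) * (4 * (m + 1)) ≤ γ / 2 * (k + 1) :=
      (mul_le_mul_of_nonneg_right h3 (by positivity)).trans hk
    nlinarith
  obtain ⟨K, hK⟩ := Filter.eventually_atTop.mp
    ((hlim1.and hlim2).and (Filter.eventually_ge_atTop 1))
  refine ⟨K, fun k hk => ?_⟩
  obtain ⟨⟨hk1, hk2⟩, hk3⟩ := hK k hk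
  have hk0 : (0 : ℝ) < k := by exact_mod_cast hk3
  obtain ⟨c, hcsum, hcq⟩ := exists_rounding q hq0 hq1 k
  obtain ⟨T, hT1, hT2⟩ := exists_words_of_counts c hcsum
  have hclose : ∀ t, |(c t : ℝ) / k - q t| ≤ m / k := by
    intro t
    rw [show (c t : ℝ) / k - q t = (c t - k * q t) / k by field_simp, abs_div, abs_of_pos hk0]
    gcongr
    exact hcq t
  refine ⟨T, fun w hw t => by rw [freqIn, hT1 w hw t]; exact hclose t, ?_⟩
  have hent : ∑ t, Real.negMulLog (q t) - γ / 2 ≤ ∑ t, Real.negMulLog ((c t : ℝ) / k) := by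
    have h := hηc (x := fun t => (c t : ℝ) / k) (by
      rw [dist_pi_lt_iff hη]
      exact fun t => (hclose t).trans_lt hk1)
    rw [Real.dist_eq, abs_lt] at h
    linarith [h.1]
  have hcsum' : ∑ t, (c t : ℝ) = k := by exact_mod_cast hcsum
  have hsum : k * ∑ t, Real.negMulLog ((c t : ℝ) / k)
      = k * Real.log k - ∑ t, (c t : ℝ) * Real.log (c t) := by
    have : ∀ t, k * Real.negMulLog ((c t : ℝ) / k)
        = c t * Real.log k - c t * Real.log (c t) := by
      intro t
      rcases Nat.eq_zero_or_pos (c t) with h | h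
      · simp [h]
      · have h' : (0 : ℝ) < c t := by exact_mod_cast h
        rw [Real.negMulLog, Real.log_div h'.ne' hk0.ne']
        field_simp
        ring
    rw [Finset.mul_sum, Finset.sum_congr rfl fun t _ => this t, Finset.sum_sub_distrib,
      ← Finset.sum_mul, hcsum']
  have hTpos : (0 : ℝ) < T.card := by
    rcases Nat.eq_zero_or_pos T.card with h | h
    · rw [h, zero_mul] at hT2
      exact absurd hT2 (by simpa using (Nat.factorial_pos k).ne')
    · exact_mod_cast h
  have hT3 : Real.log (k.factorial : ℝ)
      ≤ Real.log T.card + ∑ t, Real.log ((c t).factorial : ℝ) := by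
    rw [← Real.log_prod fun t _ => by positivity,
      ← Real.log_mul hTpos.ne' (Finset.prod_ne_zero_iff.mpr fun t _ => by positivity)]
    exact Real.log_le_log (by positivity) (by exact_mod_cast hT2)
  have hfac : ∑ t, Real.log ((c t).factorial : ℝ)
      ≤ ∑ t, (c t : ℝ) * Real.log (c t) - k + m * (2 * Real.log ((k : ℝ) + 1)) := by
    calc ∑ t, Real.log ((c t).factorial : ℝ)
        ≤ ∑ t, ((c t : ℝ) * Real.log (c t) - c t + 2 * Real.log ((k : ℝ) + 1)) := by
          refine Finset.sum_le_sum fun t _ => (log_factorial_le (c t)).trans ?_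
          have : (c t : ℝ) ≤ k := by
            exact_mod_cast hcsum ▸ Finset.single_le_sum (f := c) (fun _ _ => Nat.zero_le _)
              (Finset.mem_univ t)
          gcongr
      _ = _ := by
          rw [Finset.sum_add_distrib, Finset.sum_sub_distrib, hcsum']
          simp
  rw [← Real.le_log_iff_exp_le hTpos]
  have h1 := le_log_factorial k
  have h2 := mul_le_mul_of_nonneg_left hent hk0.le
  linarith

/-- **Corollary (well-separated injections into words).** Let `ξ` (cells `C`)
refine `β` (cells `B`) with coarsening map `π`, let `q` be a finite probability
vector, and let `0 < r ≤ 1` with `H(ξ|β) < r·H(q)`.  Then there are `δ > 0`,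
`ε₀ > 0` and `n₀ ∈ ℕ` such that for all `0 < ε ≤ ε₀` and `n ≥ n₀/ε` and every
`b ∈ L^n_{β,ε}` there is an injection
`f_b : {c ∈ L^n_{ξ,ε} : π∘c = b} → L^{⌊rn⌋}_{q,ε}` with
`d̄(f_b(c), f_b(c')) > 20·δ·|q|` for all `c ≠ c'` in its domain. -/
theorem exists_separated_injections
    {X : Type*} [MeasurableSpace X] (μ : Measure X) [IsProbabilityMeasure μ]
    (m m' : ℕ) (C : Fin m → Set X) (B : Fin m' → Set X) (π : Fin m → Fin m')
    (hmC : ∀ t, MeasurableSet (C t)) (hdC : Pairwise (Function.onFun Disjoint C))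
    (huC : μ (⋃ t, C t) = 1)
    (hmB : ∀ t, MeasurableSet (B t)) (hdB : Pairwise (Function.onFun Disjoint B))
    (huB : μ (⋃ t, B t) = 1)
    (hrefine : ∀ t, C t ⊆ B (π t))
    (kq : ℕ) (q : Fin kq → ℝ) (hq0 : ∀ t, 0 ≤ q t) (hq1 : ∑ t, q t = 1)
    (r : ℝ) (hr0 : 0 < r) (hr1 : r ≤ 1)
    (hent : (∑ t, -((μ (C t)).toReal *
        Real.log ((μ (C t)).toReal / (μ (B (π t))).toReal))) <
      r * ∑ t, Real.negMulLog (q t)) :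
    ∃ (δ : ℝ) (ε₀ : ℝ) (n₀ : ℕ), 0 < δ ∧ 0 < ε₀ ∧
      ∀ ε : ℝ, 0 < ε → ε ≤ ε₀ → ∀ n : ℕ, (n₀ : ℝ) / ε ≤ n →
        ∀ b : Fin n → Fin m', (∀ t', |freqIn b t' - (μ (B t')).toReal| ≤ ε) →
          ∃ f : (Fin n → Fin m) → (Fin ⌊r * n⌋₊ → Fin kq),
            Set.InjOn f {c | (∀ t, |freqIn c t - (μ (C t)).toReal| ≤ ε) ∧ π ∘ c = b} ∧
            (∀ c ∈ {c : Fin n → Fin m |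
                (∀ t, |freqIn c t - (μ (C t)).toReal| ≤ ε) ∧ π ∘ c = b},
              ∀ t : Fin kq, |freqIn (f c) t - q t| ≤ ε) ∧
            ∀ c ∈ {c : Fin n → Fin m |
                (∀ t, |freqIn c t - (μ (C t)).toReal| ≤ ε) ∧ π ∘ c = b},
              ∀ c' ∈ {c : Fin n → Fin m |
                (∀ t, |freqIn c t - (μ (C t)).toReal| ≤ ε) ∧ π ∘ c = b},
              c ≠ c' → dbar (f c) (f c') > 20 * δ * kq := by
  classical
  set p : Fin m → ℝ := fun t => (μ (C t)).toReal with hp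
  set s : Fin m' → ℝ := fun u => (μ (B u)).toReal with hs
  have hfib : ∀ S : Finset (Fin m), ∑ t ∈ S, p t = (μ (⋃ t ∈ S, C t)).toReal := by
    intro S
    rw [measure_biUnion_finset (fun i _ j _ hij => hdC hij) fun t _ => hmC t,
      ENNReal.toReal_sum fun t _ => measure_ne_top μ _]
  have hp1 : ∑ t, p t ≤ 1 := by
    rw [hfib]
    exact measureReal_le_one
  have hps : ∀ u, ∑ t with π t = u, p t ≤ s u := by
    intro u
    rw [hfib]
    refine ENNReal.toReal_mono (measure_ne_top μ _) (measure_mono ?_)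
    refine Set.iUnion₂_subset fun t ht => ?_
    rw [← (Finset.mem_filter.mp ht).2]
    exact hrefine t
  set Hq : ℝ := ∑ t, Real.negMulLog (q t) with hHq
  set Hc : ℝ := ∑ t, -(p t * Real.log (p t / s (π t))) with hHc
  have hγ : 0 < (r * Hq - Hc) / 4 := by
    have : Hc < r * Hq := hent
    linarith
  set γ : ℝ := (r * Hq - Hc) / 4 with hγdef
  have hq_le : ∀ t, q t ≤ 1 := fun t =>
    hq1 ▸ Finset.single_le_sum (fun t _ => hq0 t) (Finset.mem_univ t)
  have hHq0 : 0 ≤ Hq := Finset.sum_nonneg fun t _ => Real.negMulLog_nonneg (hq0 t) (hq_le t)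
  have hkq : 0 < kq := by
    rcases Nat.eq_zero_or_pos kq with rfl | h
    · simp at hq1
    · exact h
  have hkq' : (0 : ℝ) < kq := by exact_mod_cast hkq
  obtain ⟨ε₁, hε₁, hD⟩ :=
    exists_card_words_over_le_exp π p s (fun t => ENNReal.toReal_nonneg) hp1 hps hγ
  obtain ⟨ρ, hρ, hball⟩ := exists_card_dbar_ball_le_exp kq hγ
  obtain ⟨K, hT⟩ := exists_exp_le_card_words q hq0 hq1 hγ
  refine ⟨ρ / (20 * kq), min ε₁ 1, ⌈(kq + K + 2) / r⌉₊ + ⌈Hq / γ⌉₊, by positivity,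
    lt_min hε₁ one_pos, ?_⟩
  intro ε hε hε0 n hn b _
  have hεε₁ : ε ≤ ε₁ := hε0.trans (min_le_left _ _)
  have hε1 : ε ≤ 1 := hε0.trans (min_le_right _ _)
  have hn1 : (kq + K + 2) / r + Hq / γ ≤ n * ε := by
    rw [div_le_iff₀ hε] at hn
    push_cast at hn
    linarith [Nat.le_ceil ((kq + K + 2) / r), Nat.le_ceil (Hq / γ)]
  have hn2 : (n : ℝ) * ε ≤ n := mul_le_of_le_one_right (Nat.cast_nonneg n) hε1
  have hHqγ : 0 ≤ Hq / γ := by positivity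
  have hrn : kq + K + 2 ≤ r * (n * ε) := by
    have h : (kq + K + 2) / r ≤ n * ε := by linarith
    rw [div_le_iff₀ hr0] at h
    linarith
  have hrn' : kq + K + 2 ≤ r * n := hrn.trans (by gcongr)
  have hγn : Hq ≤ n * γ := by
    have h0 : 0 ≤ (kq + K + 2) / r := by positivity
    have h : Hq / γ ≤ n := by linarith
    rwa [div_le_iff₀ hγ] at h
  set k : ℕ := ⌊r * n⌋₊ with hk
  have hk_le : (k : ℝ) ≤ r * n := Nat.floor_le (by positivity)
  have hk_gt : r * n < k + 1 := Nat.lt_floor_add_one _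
  have hK0 : (0 : ℝ) ≤ K := Nat.cast_nonneg K
  have hk0' : (0 : ℝ) < k := by linarith
  have hk0 : 0 < k := by exact_mod_cast hk0'
  have hkK : K ≤ k := by
    have : (K : ℝ) ≤ k := by linarith
    exact_mod_cast this
  have hn0 : 0 < n := by
    rcases Nat.eq_zero_or_pos n with h | h
    · rw [h] at hrn'
      norm_num at hrn'
      linarith
    · exact h
  have hkε : (kq : ℝ) / k ≤ ε := by
    rw [div_le_iff₀ hk0']
    nlinarith
  obtain ⟨T, hTfreq, hTcard⟩ := hT k hkK
  obtain ⟨P, hPT, hPsep, hPcard⟩ :=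
    exists_separated_subset T ρ (Real.exp (k * γ)) hρ.le (hball k hk0)
  set D : Finset (Fin n → Fin m) :=
    Finset.univ.filter fun c => (∀ t, |freqIn c t - p t| ≤ ε) ∧ π ∘ c = b with hDdef
  have hDcard := hD ε hεε₁ n hn0 b D fun c hc => (Finset.mem_filter.mp hc).2
  have hDP : D.card ≤ P.card := by
    have h1 : Real.exp (k * (Hq - γ) - k * γ) ≤ P.card := by
      rw [Real.exp_sub, div_le_iff₀ (Real.exp_pos _)]
      exact hTcard.trans hPcard
    have h2 : n * (Hc + γ) ≤ k * (Hq - γ) - k * γ := by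
      have h3 : (k : ℝ) * γ ≤ n * γ := by
        refine mul_le_mul_of_nonneg_right ?_ hγ.le
        exact hk_le.trans (mul_le_of_le_one_left (Nat.cast_nonneg n) hr1)
      have h4 : (r * n - 1) * Hq ≤ k * Hq := by
        gcongr
        linarith
      have h5 : n * (r * Hq) = n * Hc + 4 * (n * γ) := by
        rw [hγdef]
        ring
      nlinarith
    exact_mod_cast hDcard.trans ((Real.exp_le_exp.mpr h2).trans h1)
  obtain ⟨e⟩ := Function.Embedding.nonempty_of_card_le (α := D) (β := P) (by simpa using hDP)
  let f : (Fin n → Fin m) → Fin k → Fin kq := fun c =>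
    if h : c ∈ D then (e ⟨c, h⟩ : Fin k → Fin kq) else fun _ => ⟨0, hkq⟩
  have hfe : ∀ c (h : c ∈ D), f c = e ⟨c, h⟩ := fun c h => dif_pos h
  have hDmem : ∀ c, c ∈ {c : Fin n → Fin m | (∀ t, |freqIn c t - p t| ≤ ε) ∧ π ∘ c = b} ↔
      c ∈ D := fun c => by simp [hDdef]
  have hinj : ∀ c ∈ D, ∀ c' ∈ D, f c = f c' → c = c' := by
    intro c hc c' hc' h
    rw [hfe c hc, hfe c' hc'] at h
    simpa using e.injective (Subtype.ext h)
  refine ⟨f, fun c hc c' hc' h => hinj c ((hDmem c).mp hc) c' ((hDmem c').mp hc') h, ?_, ?_⟩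
  · intro c hc t
    rw [hfe c ((hDmem c).mp hc)]
    exact (hTfreq _ (hPT (e _).2) t).trans hkε
  · intro c hc c' hc' hne
    have hc := (hDmem c).mp hc
    have hc' := (hDmem c').mp hc'
    have h := hPsep (f c) (by rw [hfe c hc]; exact (e _).2) (f c')
      (by rw [hfe c' hc']; exact (e _).2) fun h => hne (hinj c hc c' hc' h)
    rwa [show 20 * (ρ / (20 * kq)) * kq = ρ by field_simp]
end
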